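/- The integral of the piecewise Hessian of the function equal to φ on T and to ψ on K is the diagonal matrix diag(0, γ) with γ ≠ 0: more precisely, ∫_T ∂²ₓₓφ dx dy + ∫_K ∂²ₓₓψ dx dy = 0, ∫_T ∂²ₓᵧφ dx dy + ∫_K ∂²ₓᵧψ dx dy = 0, and ∫_T ∂²ᵧᵧφ dx dy + ∫_K ∂²ᵧᵧψ dx dy = −(a+b)/2 ≠ 0. -/

import Mathlib

open MvPolynomial MeasureTheory

/-- The Adini shape-function space `𝒜 = P₃ + span{x³y, xy³}`, spanned by the
twelve monomials `1, x, y, x², xy, y², x³, x²y, xy², y³, x³y, xy³`. -/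
noncomputable def AdiniSpace : Submodule ℝ (MvPolynomial (Fin 2) ℝ) :=
  Submodule.span ℝ
    ({1, X 0, X 1, X 0 ^ 2, X 0 * X 1, X 1 ^ 2, X 0 ^ 3, X 0 ^ 2 * X 1,
      X 0 * X 1 ^ 2, X 1 ^ 3, X 0 ^ 3 * X 1, X 0 * X 1 ^ 3} :
      Set (MvPolynomial (Fin 2) ℝ))

/-- Evaluation of a polynomial in the two variables at the point `(x, y)`. -/
noncomputable def pev (x y : ℝ) (p : MvPolynomial (Fin 2) ℝ) : ℝ :=
  eval ![x, y] p

/-- Partial derivative `∂ₓ`. -/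
noncomputable def dX : MvPolynomial (Fin 2) ℝ → MvPolynomial (Fin 2) ℝ :=
  pderiv (0 : Fin 2)

/-- Partial derivative `∂_y`. -/
noncomputable def dY : MvPolynomial (Fin 2) ℝ → MvPolynomial (Fin 2) ℝ :=
  pderiv (1 : Fin 2)

/-- The Adini degree of freedom at a vertex `v` with multi-index
`β = 0 ↔ (0,0)` (point value), `β = 1 ↔ (1,0)` (`∂ₓ`), `β = 2 ↔ (0,1)` (`∂_y`). -/
noncomputable def adiniDof (β : Fin 3) (v : ℝ × ℝ) (p : MvPolynomial (Fin 2) ℝ) : ℝ :=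
  if β = 0 then pev v.1 v.2 p else if β = 1 then pev v.1 v.2 (dX p) else pev v.1 v.2 (dY p)

/-- Vertices of the reference square `[−1,1]²`:
`z₁ = (−1,−1)`, `z₂ = (1,−1)`, `z₃ = (1,1)`, `z₄ = (−1,1)`. -/
noncomputable def refVertex : Fin 4 → ℝ × ℝ := ![(-1, -1), (1, -1), (1, 1), (-1, 1)]

theorem exists_coeff_of_mem_adiniSpace {p : MvPolynomial (Fin 2) ℝ} (hp : p ∈ AdiniSpace) :
    ∃ k : Fin 12 → ℝ, p = C (k 0) + C (k 1) * X 0 + C (k 2) * X 1 + C (k 3) * X 0 ^ 2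
      + C (k 4) * (X 0 * X 1) + C (k 5) * X 1 ^ 2 + C (k 6) * X 0 ^ 3
      + C (k 7) * (X 0 ^ 2 * X 1) + C (k 8) * (X 0 * X 1 ^ 2) + C (k 9) * X 1 ^ 3
      + C (k 10) * (X 0 ^ 3 * X 1) + C (k 11) * (X 0 * X 1 ^ 3) := by
  simp only [AdiniSpace, Submodule.mem_span_insert, Submodule.mem_span_singleton] at hp
  obtain ⟨k0, _, ⟨k1, _, ⟨k2, _, ⟨k3, _, ⟨k4, _, ⟨k5, _, ⟨k6, _, ⟨k7, _, ⟨k8, _, ⟨k9, _,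
    ⟨k10, _, ⟨k11, rfl⟩, rfl⟩, rfl⟩, rfl⟩, rfl⟩, rfl⟩, rfl⟩, rfl⟩, rfl⟩, rfl⟩, rfl⟩, rfl⟩ := hp
  refine ⟨![k0, k1, k2, k3, k4, k5, k6, k7, k8, k9, k10, k11], ?_⟩
  simp only [MvPolynomial.smul_eq_C_mul, mul_one]
  simp
  ring

/-- The basis function on the rectangle spanned by `(0, 0)` and `(w, c)` is
`(1 - x / w) * y * (1 - y / c) ^ 2`. -/
theorem adini_basis_hessian {w c : ℝ} (hw : w ≠ 0) (hc : c ≠ 0)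
    {p : MvPolynomial (Fin 2) ℝ} (hp : p ∈ AdiniSpace)
    (h0 : ∀ β : Fin 3, adiniDof β (0, 0) p = if β = 2 then 1 else 0)
    (hv : ∀ β : Fin 3,
      adiniDof β (w, 0) p = 0 ∧ adiniDof β (w, c) p = 0 ∧ adiniDof β (0, c) p = 0) (x y : ℝ) :
    pev x y (dX (dX p)) = 0 ∧
    pev x y (dY (dX p)) = -(1 / w) * (1 - y * (4 / c) + 3 / c ^ 2 * y ^ 2) ∧
    pev x y (dY (dY p)) = (1 - x / w) * (-4 / c + y * (6 / c ^ 2)) := by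
  obtain ⟨k, rfl⟩ := exists_coeff_of_mem_adiniSpace hp
  have e0 := h0 0
  have e1 := h0 1
  have e2 := h0 2
  obtain ⟨f0, g0, i0⟩ := hv 0
  obtain ⟨f1, g1, i1⟩ := hv 1
  obtain ⟨f2, g2, i2⟩ := hv 2
  clear h0 hv hp
  have pderiv_two (i : Fin 2) : pderiv i (2 : MvPolynomial (Fin 2) ℝ) = 0 :=
    (pderiv i).map_natCast 2
  have pderiv_three (i : Fin 2) : pderiv i (3 : MvPolynomial (Fin 2) ℝ) = 0 :=
    (pderiv i).map_natCast 3
  simp [adiniDof, pev, dX, dY, pderiv_X, pderiv_two, pderiv_three] at e0 e1 e2 f0 f1 f2 g0 g1 g2 i0 i1 i2 ⊢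
  rw [e0, e1] at f0
  rw [e1] at f1 i1
  rw [e0, e2] at i0
  rw [e2] at f2 i2
  rw [e0, e1, e2] at g0
  rw [e1] at g1
  rw [e2] at g2
  have k6 : k 6 = 0 := by
    have : w ^ 3 * k 6 = 0 := by linear_combination w * f1 - 2 * f0
    simpa [hw] using this
  have k3 : k 3 = 0 := by
    have : w ^ 2 * k 3 = 0 := by linear_combination f0 - w ^ 3 * k6
    simpa [hw] using this
  have k9 : k 9 = 1 / c ^ 2 := by
    field_simp
    apply mul_left_cancel₀ hc
    linear_combination c * i2 - 2 * i0
  have k5 : k 5 = -2 / c := by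
    field_simp
    apply mul_left_cancel₀ hc
    linear_combination 3 * i0 - c * i2
  have k10 : k 10 = 0 := by
    have : w ^ 3 * c * k 10 = 0 := by
      linear_combination w * (g1 - i1 - f1) - 2 * (g0 - w * i1 - i0 - f0)
    simpa [hw, hc] using this
  have k7 : k 7 = 0 := by
    have : w ^ 2 * c * k 7 = 0 := by
      linear_combination g0 - w * i1 - i0 - f0 - w ^ 3 * c * k10
    simpa [hw, hc] using this
  have hk4 : k 4 * w = -1 := by
    linear_combination f2 - w ^ 2 * k7 - w ^ 3 * k10
  have hk11 : k 11 * (w * c ^ 2) = -1 := by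
    apply mul_left_cancel₀ hc
    linear_combination c * (g2 - i2 + f2) - 2 * w * i1 - 2 * c * w ^ 2 * k7 - 2 * c * w ^ 3 * k10
  have hk8 : k 8 * (w * c) = 2 := by
    apply mul_left_cancel₀ hc
    linear_combination w * i1 - c * hk4 - c * hk11
  have k4 : k 4 = -1 / w := by rw [eq_div_iff hw, hk4]
  have k8 : k 8 = 2 / (w * c) := by rw [eq_div_iff (by positivity), hk8]
  have k11 : k 11 = -1 / (w * c ^ 2) := by rw [eq_div_iff (by positivity), hk11]
  rw [k3, k4, k5, k6, k7, k8, k9, k10, k11]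
  refine ⟨by ring, ?_, ?_⟩
  · field_simp
    ring
  · field_simp
    ring

theorem integral_adini_basis_hessian {w c : ℝ} (hw : w ≠ 0) (hc : c ≠ 0)
    {p : MvPolynomial (Fin 2) ℝ} (hp : p ∈ AdiniSpace)
    (h0 : ∀ β : Fin 3, adiniDof β (0, 0) p = if β = 2 then 1 else 0)
    (hv : ∀ β : Fin 3,
      adiniDof β (w, 0) p = 0 ∧ adiniDof β (w, c) p = 0 ∧ adiniDof β (0, c) p = 0) :
    (∫ x in (0 : ℝ)..w, ∫ y in (0 : ℝ)..c, pev x y (dX (dX p))) = 0 ∧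
    (∫ x in (0 : ℝ)..w, ∫ y in (0 : ℝ)..c, pev x y (dY (dX p))) = 0 ∧
    (∫ x in (0 : ℝ)..w, ∫ y in (0 : ℝ)..c, pev x y (dY (dY p))) = -(w / 2) := by
  have h := adini_basis_hessian hw hc hp h0 hv
  simp only [fun x y => (h x y).1, fun x y => (h x y).2.1, fun x y => (h x y).2.2]
  have hxy : ∫ y in (0 : ℝ)..c, (1 - y * (4 / c) + 3 / c ^ 2 * y ^ 2) = 0 := by
    rw [intervalIntegral.integral_add (Continuous.intervalIntegrable (by fun_prop) _ _) (Continuous.intervalIntegrable (by fun_prop) _ _),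
      intervalIntegral.integral_sub (Continuous.intervalIntegrable (by fun_prop) _ _) (Continuous.intervalIntegrable (by fun_prop) _ _)]
    simp only [intervalIntegral.integral_mul_const, intervalIntegral.integral_const_mul,
      intervalIntegral.integral_const, integral_id, integral_pow, smul_eq_mul]
    field_simp
    ring
  have hyy : ∫ y in (0 : ℝ)..c, (-4 / c + y * (6 / c ^ 2)) = -1 := by
    rw [intervalIntegral.integral_add (Continuous.intervalIntegrable (by fun_prop) _ _) (Continuous.intervalIntegrable (by fun_prop) _ _)]
    simp only [intervalIntegral.integral_mul_const,
      intervalIntegral.integral_const, integral_id, smul_eq_mul]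
    field_simp
    ring
  have hx : ∫ x in (0 : ℝ)..w, (1 - x / w) = w / 2 := by
    rw [intervalIntegral.integral_sub (Continuous.intervalIntegrable (by fun_prop) _ _) (Continuous.intervalIntegrable (by fun_prop) _ _)]
    simp only [intervalIntegral.integral_div,
      intervalIntegral.integral_const, integral_id, smul_eq_mul]
    field_simp
    ring
  refine ⟨by simp, ?_, ?_⟩
  · simp only [intervalIntegral.integral_const_mul, hxy]
    simp
  · simp only [intervalIntegral.integral_const_mul, hyy, intervalIntegral.integral_mul_const, hx]
    ring

/-- **Lemma l:nonzeroint.** For the Adini basis functions `φ`, `ψ` of the degree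
of freedom `∂_y` at the shared vertex `z = (0,0)` on `T = [0,a] × [0,c]` and
`K = [−b,0] × [0,c]`, the integral of the piecewise Hessian is the diagonal
matrix `diag(0, γ)` with `γ = −(a+b)/2 ≠ 0`. -/
theorem adini_nonzero_hessian_integral (a b c : ℝ) (ha : 0 < a) (hb : 0 < b) (hc : 0 < c)
    (φ ψ : MvPolynomial (Fin 2) ℝ) (hφA : φ ∈ AdiniSpace) (hψA : ψ ∈ AdiniSpace)
    (hφ0 : ∀ β : Fin 3, adiniDof β (0, 0) φ = if β = 2 then 1 else 0)
    (hφv : ∀ β : Fin 3,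
      adiniDof β (a, 0) φ = 0 ∧ adiniDof β (a, c) φ = 0 ∧ adiniDof β (0, c) φ = 0)
    (hψ0 : ∀ β : Fin 3, adiniDof β (0, 0) ψ = if β = 2 then 1 else 0)
    (hψv : ∀ β : Fin 3,
      adiniDof β (-b, 0) ψ = 0 ∧ adiniDof β (-b, c) ψ = 0 ∧ adiniDof β (0, c) ψ = 0) :
    (∫ x in (0 : ℝ)..a, ∫ y in (0 : ℝ)..c, pev x y (dX (dX φ)))
        + (∫ x in (-b : ℝ)..0, ∫ y in (0 : ℝ)..c, pev x y (dX (dX ψ))) = 0 ∧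
    (∫ x in (0 : ℝ)..a, ∫ y in (0 : ℝ)..c, pev x y (dY (dX φ)))
        + (∫ x in (-b : ℝ)..0, ∫ y in (0 : ℝ)..c, pev x y (dY (dX ψ))) = 0 ∧
    (∫ x in (0 : ℝ)..a, ∫ y in (0 : ℝ)..c, pev x y (dY (dY φ)))
        + (∫ x in (-b : ℝ)..0, ∫ y in (0 : ℝ)..c, pev x y (dY (dY ψ)))
      = -((a + b) / 2) ∧
    -((a + b) / 2) ≠ 0 := by
  obtain ⟨p1, p2, p3⟩ := integral_adini_basis_hessian ha.ne' hc.ne' hφA hφ0 hφv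
  obtain ⟨q1, q2, q3⟩ := integral_adini_basis_hessian (neg_ne_zero.mpr hb.ne') hc.ne' hψA hψ0 hψv
  rw [intervalIntegral.integral_symm 0 (-b), intervalIntegral.integral_symm 0 (-b),
    intervalIntegral.integral_symm 0 (-b), p1, p2, p3, q1, q2, q3]
  exact ⟨by ring, by ring, by ring, neg_ne_zero.mpr (by positivity)⟩
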